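/- Let Ω ⊆ {(ρ,z) ∈ ℝ² : ρ > 0} and let U₁, U₂ : ℝ² → ℝ be twice continuously differentiable on Ω satisfying, at every point of Ω and for i = 1, 2: ∂U_i/∂ρ > 0, ∂²U_i/∂z² < 0, and ρ·∂U_i/∂ρ + (∂U_i/∂ρ)²·(∂²U_i/∂z²)/((∂²U_i/∂ρ∂z)² + (∂²U_i/∂z²)²) < 0. Let a₁, a₂ > 0 with a₁ + a₂ = 1 and set U := a₁U₁ + a₂U₂. Then at every point of Ω: ∂U/∂ρ > 0, ∂²U/∂z² < 0 (in particular (∂²U/∂ρ∂z)² + (∂²U/∂z²)² > 0), and ρ·∂U/∂ρ + (∂U/∂ρ)²·(∂²U/∂z²)/((∂²U/∂ρ∂z)² + (∂²U/∂z²)²) < 0. -/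

import Mathlib

open Real Set

/-- Partial derivative with respect to the first variable. -/
noncomputable def pdr (U : ℝ → ℝ → ℝ) (ρ z : ℝ) : ℝ := deriv (fun t => U t z) ρ

/-- Partial derivative with respect to the second variable. -/
noncomputable def pdz (U : ℝ → ℝ → ℝ) (ρ z : ℝ) : ℝ := deriv (fun t => U ρ t) z

/-- Second partial derivative with respect to the second variable. -/
noncomputable def pdzz (U : ℝ → ℝ → ℝ) (ρ z : ℝ) : ℝ := deriv (fun t => pdz U ρ t) z

/-- Mixed second partial derivative: first in the second variable, then in the first. -/
noncomputable def pdrz (U : ℝ → ℝ → ℝ) (ρ z : ℝ) : ℝ := deriv (fun t => pdz U t z) ρ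

open Topology

theorem hasDerivAt_slice_fst {f : ℝ → ℝ → ℝ} {p : ℝ × ℝ}
    (h : DifferentiableAt ℝ (fun q : ℝ × ℝ => f q.1 q.2) p) :
    HasDerivAt (fun t => f t p.2) (pdr f p.1 p.2) p.1 := by
  have h' : DifferentiableAt ℝ (fun t => f t p.2) p.1 :=
    DifferentiableAt.comp (g := fun q : ℝ × ℝ => f q.1 q.2) (f := fun t : ℝ => (t, p.2)) p.1 h
      (by fun_prop)
  exact h'.hasDerivAt

theorem hasDerivAt_slice_snd {f : ℝ → ℝ → ℝ} {p : ℝ × ℝ}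
    (h : DifferentiableAt ℝ (fun q : ℝ × ℝ => f q.1 q.2) p) :
    HasDerivAt (fun t => f p.1 t) (pdz f p.1 p.2) p.2 := by
  have h' : DifferentiableAt ℝ (fun t => f p.1 t) p.2 :=
    DifferentiableAt.comp (g := fun q : ℝ × ℝ => f q.1 q.2) (f := fun t : ℝ => (p.1, t)) p.2 h
      (by fun_prop)
  exact h'.hasDerivAt

theorem pdz_eq_fderiv {f : ℝ → ℝ → ℝ} {p : ℝ × ℝ}
    (h : DifferentiableAt ℝ (fun q : ℝ × ℝ => f q.1 q.2) p) :
    pdz f p.1 p.2 = fderiv ℝ (fun q : ℝ × ℝ => f q.1 q.2) p (0, 1) := by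
  have hs : HasDerivAt (fun t : ℝ => (p.1, t)) (0, 1) p.2 :=
    (hasDerivAt_const p.2 p.1).prodMk (hasDerivAt_id p.2)
  exact (HasFDerivAt.comp_hasDerivAt (l := fun q : ℝ × ℝ => f q.1 q.2) p.2 h.hasFDerivAt hs).deriv

theorem eventually_differentiableAt_of_contDiffAt_two {F : ℝ × ℝ → ℝ} {p : ℝ × ℝ}
    (h : ContDiffAt ℝ 2 F p) : ∀ᶠ q in 𝓝 p, DifferentiableAt ℝ F q :=
  (h.eventually (by simp)).mono fun _ hq => hq.differentiableAt (by simp)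

theorem differentiableAt_pdz {f : ℝ → ℝ → ℝ} {p : ℝ × ℝ}
    (h : ContDiffAt ℝ 2 (fun q : ℝ × ℝ => f q.1 q.2) p) :
    DifferentiableAt ℝ (fun q : ℝ × ℝ => pdz f q.1 q.2) p := by
  have h1 : DifferentiableAt ℝ (fderiv ℝ (fun q : ℝ × ℝ => f q.1 q.2)) p :=
    (h.fderiv_right (m := 1) (by norm_num)).differentiableAt (by simp)
  have h2 := h1.clm_apply (differentiableAt_const ((0, 1) : ℝ × ℝ))
  refine h2.congr_of_eventuallyEq ?_
  filter_upwards [eventually_differentiableAt_of_contDiffAt_two h] with q hq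
  exact pdz_eq_fderiv hq

section LinearCombination

variable {U₁ U₂ U : ℝ → ℝ → ℝ} {a₁ a₂ : ℝ} {p : ℝ × ℝ}

theorem pdr_linearCombination (hU : ∀ ρ z : ℝ, U ρ z = a₁ * U₁ ρ z + a₂ * U₂ ρ z)
    (h₁ : DifferentiableAt ℝ (fun q : ℝ × ℝ => U₁ q.1 q.2) p)
    (h₂ : DifferentiableAt ℝ (fun q : ℝ × ℝ => U₂ q.1 q.2) p) :
    pdr U p.1 p.2 = a₁ * pdr U₁ p.1 p.2 + a₂ * pdr U₂ p.1 p.2 := by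
  obtain rfl : U = fun ρ z => a₁ * U₁ ρ z + a₂ * U₂ ρ z := by ext; exact hU _ _
  exact (((hasDerivAt_slice_fst h₁).const_mul a₁).add
    ((hasDerivAt_slice_fst h₂).const_mul a₂)).deriv

theorem pdz_linearCombination (hU : ∀ ρ z : ℝ, U ρ z = a₁ * U₁ ρ z + a₂ * U₂ ρ z)
    (h₁ : DifferentiableAt ℝ (fun q : ℝ × ℝ => U₁ q.1 q.2) p)
    (h₂ : DifferentiableAt ℝ (fun q : ℝ × ℝ => U₂ q.1 q.2) p) :
    pdz U p.1 p.2 = a₁ * pdz U₁ p.1 p.2 + a₂ * pdz U₂ p.1 p.2 := by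
  obtain rfl : U = fun ρ z => a₁ * U₁ ρ z + a₂ * U₂ ρ z := by ext; exact hU _ _
  exact (((hasDerivAt_slice_snd h₁).const_mul a₁).add
    ((hasDerivAt_slice_snd h₂).const_mul a₂)).deriv

theorem eventually_pdz_linearCombination
    (hU : ∀ ρ z : ℝ, U ρ z = a₁ * U₁ ρ z + a₂ * U₂ ρ z)
    (h₁ : ContDiffAt ℝ 2 (fun q : ℝ × ℝ => U₁ q.1 q.2) p)
    (h₂ : ContDiffAt ℝ 2 (fun q : ℝ × ℝ => U₂ q.1 q.2) p) :
    ∀ᶠ q : ℝ × ℝ in 𝓝 p, pdz U q.1 q.2 = a₁ * pdz U₁ q.1 q.2 + a₂ * pdz U₂ q.1 q.2 := by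
  filter_upwards [eventually_differentiableAt_of_contDiffAt_two h₁,
    eventually_differentiableAt_of_contDiffAt_two h₂] with q hq₁ hq₂
  exact pdz_linearCombination hU hq₁ hq₂

theorem pdzz_linearCombination (hU : ∀ ρ z : ℝ, U ρ z = a₁ * U₁ ρ z + a₂ * U₂ ρ z)
    (h₁ : ContDiffAt ℝ 2 (fun q : ℝ × ℝ => U₁ q.1 q.2) p)
    (h₂ : ContDiffAt ℝ 2 (fun q : ℝ × ℝ => U₂ q.1 q.2) p) :
    pdzz U p.1 p.2 = a₁ * pdzz U₁ p.1 p.2 + a₂ * pdzz U₂ p.1 p.2 := by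
  have hc : Filter.Tendsto (fun t : ℝ => (p.1, t)) (𝓝 p.2) (𝓝 p) :=
    Continuous.tendsto (f := fun t : ℝ => (p.1, t)) (by fun_prop) p.2
  have he : (fun t => pdz U p.1 t) =ᶠ[𝓝 p.2]
      fun t => a₁ * pdz U₁ p.1 t + a₂ * pdz U₂ p.1 t :=
    hc.eventually (eventually_pdz_linearCombination hU h₁ h₂)
  exact he.deriv_eq.trans (pdz_linearCombination (U := fun ρ z => a₁ * pdz U₁ ρ z + a₂ * pdz U₂ ρ z)
    (fun _ _ => rfl) (differentiableAt_pdz h₁) (differentiableAt_pdz h₂))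

theorem pdrz_linearCombination (hU : ∀ ρ z : ℝ, U ρ z = a₁ * U₁ ρ z + a₂ * U₂ ρ z)
    (h₁ : ContDiffAt ℝ 2 (fun q : ℝ × ℝ => U₁ q.1 q.2) p)
    (h₂ : ContDiffAt ℝ 2 (fun q : ℝ × ℝ => U₂ q.1 q.2) p) :
    pdrz U p.1 p.2 = a₁ * pdrz U₁ p.1 p.2 + a₂ * pdrz U₂ p.1 p.2 := by
  have hc : Filter.Tendsto (fun t : ℝ => (t, p.2)) (𝓝 p.1) (𝓝 p) :=
    Continuous.tendsto (f := fun t : ℝ => (t, p.2)) (by fun_prop) p.1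
  have he : (fun t => pdz U t p.2) =ᶠ[𝓝 p.1]
      fun t => a₁ * pdz U₁ t p.2 + a₂ * pdz U₂ t p.2 :=
    hc.eventually (eventually_pdz_linearCombination hU h₁ h₂)
  exact he.deriv_eq.trans (pdr_linearCombination (U := fun ρ z => a₁ * pdz U₁ ρ z + a₂ * pdz U₂ ρ z)
    (fun _ _ => rfl) (differentiableAt_pdz h₁) (differentiableAt_pdz h₂))

end LinearCombination

/-- For `u > 0 > n`, negativity of `ru + u²n/(m² + n²)` says that `u` exceeds the value at `(m, -n)`
of the convex, positively homogeneous function `(m, w) ↦ r(m²/w + w)`. -/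
theorem mul_add_sq_mul_div_neg_iff {r u m n : ℝ} (hu : 0 < u) (hn : n < 0) :
    r * u + u ^ 2 * n / (m ^ 2 + n ^ 2) < 0 ↔ r * (m ^ 2 / (-n) + (-n)) < u := by
  have hD : 0 < m ^ 2 + n ^ 2 := by nlinarith [sq_nonneg m]
  have hw : 0 < -n := neg_pos.2 hn
  have e₁ : r * u + u ^ 2 * n / (m ^ 2 + n ^ 2)
      = u * (r * (m ^ 2 + n ^ 2) - u * (-n)) / (m ^ 2 + n ^ 2) := by
    field_simp
    ring
  have e₂ : r * (m ^ 2 / (-n) + (-n)) = r * (m ^ 2 + n ^ 2) / (-n) := by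
    have := hn.ne
    field_simp
    ring
  rw [e₁, e₂, div_lt_iff₀ hD, zero_mul, div_lt_iff₀ hw, ← sub_neg (b := u * -n)]
  exact smul_neg_iff_of_pos_left hu

theorem add_sq_div_add_le {a₁ a₂ m₁ m₂ w₁ w₂ : ℝ} (ha₁ : 0 < a₁) (ha₂ : 0 < a₂)
    (hw₁ : 0 < w₁) (hw₂ : 0 < w₂) :
    (a₁ * m₁ + a₂ * m₂) ^ 2 / (a₁ * w₁ + a₂ * w₂)
      ≤ a₁ * (m₁ ^ 2 / w₁) + a₂ * (m₂ ^ 2 / w₂) := by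
  have hw : 0 < a₁ * w₁ + a₂ * w₂ := by positivity
  have e : a₁ * (m₁ ^ 2 / w₁) + a₂ * (m₂ ^ 2 / w₂)
      - (a₁ * m₁ + a₂ * m₂) ^ 2 / (a₁ * w₁ + a₂ * w₂)
      = a₁ * a₂ * (m₁ * w₂ - m₂ * w₁) ^ 2 / (w₁ * w₂ * (a₁ * w₁ + a₂ * w₂)) := by
    field_simp
    ring
  rw [← sub_nonneg, e]
  positivity

/-- the positivity conditions `U_ρ > 0`, `U_zz < 0` and
`ρU_ρ + U_ρ²U_zz/(U_{ρz}² + U_zz²) < 0` on a subset `Ω` of the half-plane `ρ > 0`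
are preserved under barycenters `U = a₁U₁ + a₂U₂`. -/
theorem superposition_of_solutions
    (Ω : Set (ℝ × ℝ)) (hΩ : Ω ⊆ {p : ℝ × ℝ | 0 < p.1})
    (U₁ U₂ : ℝ → ℝ → ℝ)
    (hC₁ : ∀ p ∈ Ω, ContDiffAt ℝ 2 (fun q : ℝ × ℝ => U₁ q.1 q.2) p)
    (hC₂ : ∀ p ∈ Ω, ContDiffAt ℝ 2 (fun q : ℝ × ℝ => U₂ q.1 q.2) p)
    (hpos₁ : ∀ p ∈ Ω, 0 < pdr U₁ p.1 p.2)
    (hpos₂ : ∀ p ∈ Ω, 0 < pdr U₂ p.1 p.2)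
    (hneg₁ : ∀ p ∈ Ω, pdzz U₁ p.1 p.2 < 0)
    (hneg₂ : ∀ p ∈ Ω, pdzz U₂ p.1 p.2 < 0)
    (hV₁ : ∀ p ∈ Ω, p.1 * pdr U₁ p.1 p.2 +
      (pdr U₁ p.1 p.2) ^ 2 * pdzz U₁ p.1 p.2
        / ((pdrz U₁ p.1 p.2) ^ 2 + (pdzz U₁ p.1 p.2) ^ 2) < 0)
    (hV₂ : ∀ p ∈ Ω, p.1 * pdr U₂ p.1 p.2 +
      (pdr U₂ p.1 p.2) ^ 2 * pdzz U₂ p.1 p.2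
        / ((pdrz U₂ p.1 p.2) ^ 2 + (pdzz U₂ p.1 p.2) ^ 2) < 0)
    (a₁ a₂ : ℝ) (ha₁ : 0 < a₁) (ha₂ : 0 < a₂) (hsum : a₁ + a₂ = 1)
    (U : ℝ → ℝ → ℝ) (hU : ∀ ρ z : ℝ, U ρ z = a₁ * U₁ ρ z + a₂ * U₂ ρ z) :
    ∀ p ∈ Ω,
      0 < pdr U p.1 p.2 ∧
      pdzz U p.1 p.2 < 0 ∧
      0 < (pdrz U p.1 p.2) ^ 2 + (pdzz U p.1 p.2) ^ 2 ∧
      p.1 * pdr U p.1 p.2 +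
        (pdr U p.1 p.2) ^ 2 * pdzz U p.1 p.2
          / ((pdrz U p.1 p.2) ^ 2 + (pdzz U p.1 p.2) ^ 2) < 0 := by
  intro p hp
  have hd₁ := (hC₁ p hp).differentiableAt (by simp)
  have hd₂ := (hC₂ p hp).differentiableAt (by simp)
  rw [pdr_linearCombination hU hd₁ hd₂, pdzz_linearCombination hU (hC₁ p hp) (hC₂ p hp),
    pdrz_linearCombination hU (hC₁ p hp) (hC₂ p hp)]
  have hr : 0 < p.1 := hΩ hp
  have hu₁ := hpos₁ p hp
  have hu₂ := hpos₂ p hp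
  have hn₁ := hneg₁ p hp
  have hn₂ := hneg₂ p hp
  have k₁ := (mul_add_sq_mul_div_neg_iff hu₁ hn₁).1 (hV₁ p hp)
  have k₂ := (mul_add_sq_mul_div_neg_iff hu₂ hn₂).1 (hV₂ p hp)
  generalize pdr U₁ p.1 p.2 = u₁ at *
  generalize pdr U₂ p.1 p.2 = u₂ at *
  generalize pdzz U₁ p.1 p.2 = n₁ at *
  generalize pdzz U₂ p.1 p.2 = n₂ at *
  generalize pdrz U₁ p.1 p.2 = m₁ at *
  generalize pdrz U₂ p.1 p.2 = m₂ at *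
  have hu : 0 < a₁ * u₁ + a₂ * u₂ := by positivity
  have hn : a₁ * n₁ + a₂ * n₂ < 0 :=
    add_neg (mul_neg_of_pos_of_neg ha₁ hn₁) (mul_neg_of_pos_of_neg ha₂ hn₂)
  refine ⟨hu, hn, add_pos_of_nonneg_of_pos (sq_nonneg _) (sq_pos_of_neg hn),
    (mul_add_sq_mul_div_neg_iff hu hn).2 ?_⟩
  have e : -(a₁ * n₁ + a₂ * n₂) = a₁ * (-n₁) + a₂ * (-n₂) := by ring
  rw [e]
  calc p.1 * ((a₁ * m₁ + a₂ * m₂) ^ 2 / (a₁ * (-n₁) + a₂ * (-n₂)) + (a₁ * (-n₁) + a₂ * (-n₂)))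
      ≤ p.1 * (a₁ * (m₁ ^ 2 / (-n₁)) + a₂ * (m₂ ^ 2 / (-n₂)) + (a₁ * (-n₁) + a₂ * (-n₂))) := by
        gcongr
        exact add_sq_div_add_le ha₁ ha₂ (neg_pos.2 hn₁) (neg_pos.2 hn₂)
    _ = a₁ * (p.1 * (m₁ ^ 2 / (-n₁) + (-n₁))) + a₂ * (p.1 * (m₂ ^ 2 / (-n₂) + (-n₂))) := by ring
    _ < a₁ * u₁ + a₂ * u₂ := by gcongr
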